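/- arXiv:1512.06343 — 8 statements merged into one kernel-verified Lean document; each statement's English description precedes it below -/
import Mathlib

section
/- Let V be a finite-dimensional real vector space and let ζ and η be 2-forms on V such that ζ ∧ η = 0 (as a 4-form) and ζ ≠ 0. If rank ζ > 4, then η = 0. -/
open Module

/-- The wedge product of two 2-forms (alternating bilinear forms) on a real vector
space `V`, evaluated on four vectors, given by the usual alternating sum over all
permutations (a positive multiple, `2!·2!`, of the standard normalisation). -/
noncomputable def wedge22 {V : Type*} [AddCommGroup V] [Module ℝ V]
    (ζ η : V →ₗ[ℝ] V →ₗ[ℝ] ℝ) : (Fin 4 → V) → ℝ :=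
  fun v => ∑ σ : Equiv.Perm (Fin 4),
    ((Equiv.Perm.sign σ : ℤ) : ℝ) * (ζ (v (σ 0)) (v (σ 1)) * η (v (σ 2)) (v (σ 3)))

/-- Expansion of `wedge22 ζ η` over the six splittings of four vectors into two pairs. -/
theorem wedge22_apply_of_alternating {V : Type*} [AddCommGroup V] [Module ℝ V]
    (ζ η : V →ₗ[ℝ] V →ₗ[ℝ] ℝ) (hζ : ∀ v w, ζ v w = -ζ w v) (hη : ∀ v w, η v w = -η w v)
    (a b c d : V) :
    wedge22 ζ η ![a, b, c, d] = 4 * (ζ a b * η c d - ζ a c * η b d + ζ a d * η b c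
      + ζ b c * η a d - ζ b d * η a c + ζ c d * η a b) := by
  have hsum {n : ℕ} (f : Equiv.Perm (Fin (n + 1)) → ℝ) :
      ∑ σ, f σ = ∑ i, ∑ σ, f (Equiv.Perm.decomposeFin.symm (i, σ)) := by
    rw [← Equiv.sum_comp Equiv.Perm.decomposeFin.symm, Fintype.sum_prod_type]
  have h2 : (2 : Fin 4) = Fin.succ (Fin.succ 0) := rfl
  have h3 : (3 : Fin 4) = Fin.succ (Fin.succ (Fin.succ 0)) := rfl
  simp only [wedge22, hsum, Fintype.sum_unique, Fin.sum_univ_four, Fin.sum_univ_three,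
    Fin.sum_univ_two, Fin.isValue]
  simp only [h2, h3, ← Fin.succ_zero_eq_one, Equiv.Perm.decomposeFin_symm_apply_zero,
    Equiv.Perm.decomposeFin_symm_apply_succ, Equiv.Perm.decomposeFin.symm_sign]
  simp [Equiv.swap_apply_def]
  rw [hζ b a, hζ c a, hζ d a, hζ c b, hζ d b, hζ d c,
    hη b a, hη c a, hη d a, hη c b, hη d b, hη d c]
  ring

/-- A bilinear form of rank greater than `4` does not vanish identically on the orthogonal of four
vectors, provided that this orthogonal and the four vectors together span the space. -/
theorem exists_orthogonal_pair_ne_zero {V : Type*} [AddCommGroup V] [Module ℝ V]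
    [FiniteDimensional ℝ V] (ζ : V →ₗ[ℝ] V →ₗ[ℝ] ℝ)
    (hrank : 4 < finrank ℝ V - finrank ℝ (LinearMap.ker ζ)) (u : Fin 4 → V)
    (hu : ∀ w, ∃ t : Fin 4 → ℝ, ∀ i, ζ (w - ∑ j, t j • u j) (u i) = 0) :
    ∃ g h, (∀ i, ζ g (u i) = 0) ∧ (∀ i, ζ h (u i) = 0) ∧ ζ g h ≠ 0 := by
  by_contra! H
  let L : V →ₗ[ℝ] (Fin 4 → ℝ) := LinearMap.pi fun i => ζ.flip (u i)
  have hle : LinearMap.ker L ≤ LinearMap.ker ζ := by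
    intro x hx
    have hx' : ∀ i, ζ x (u i) = 0 := fun i => congrFun (LinearMap.mem_ker.1 hx) i
    rw [LinearMap.mem_ker]
    ext w
    obtain ⟨t, ht⟩ := hu w
    simpa [map_sub, map_sum, hx'] using H x _ hx' ht
  have h1 := Submodule.finrank_mono hle
  have h2 := L.finrank_range_add_finrank_ker
  have h3 := (LinearMap.range L).finrank_le
  simp only [finrank_fin_fun] at h3
  omega

/-- If `ζ` and `η` are 2-forms on a finite-dimensional real vector space with
`ζ ∧ η = 0` and `ζ ≠ 0`, and `rank ζ > 4`, then `η = 0`. -/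
theorem stmt0 {V : Type*} [AddCommGroup V] [Module ℝ V] [FiniteDimensional ℝ V]
    (ζ η : V →ₗ[ℝ] V →ₗ[ℝ] ℝ)
    (hζalt : ∀ v, ζ v v = 0) (hηalt : ∀ v, η v v = 0)
    (hwedge : ∀ v : Fin 4 → V, wedge22 ζ η v = 0)
    (hζ : ζ ≠ 0)
    (hrank : 4 < finrank ℝ V - finrank ℝ (LinearMap.ker ζ)) :
    η = 0 := by
  have hζs : ∀ v w, ζ v w = -ζ w v := fun v w => (LinearMap.IsAlt.neg hζalt w v).symm
  have hηs : ∀ v w, η v w = -η w v := fun v w => (LinearMap.IsAlt.neg hηalt w v).symm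
  have hW : ∀ a b c d, ζ a b * η c d - ζ a c * η b d + ζ a d * η b c
      + ζ b c * η a d - ζ b d * η a c + ζ c d * η a b = 0 := by
    intro a b c d
    have h := hwedge ![a, b, c, d]
    rw [wedge22_apply_of_alternating ζ η hζs hηs] at h
    linarith
  have key : ∀ e f, ζ e f ≠ 0 → η e f = 0 := by
    intro e f hef
    have hfe := hζs f e
    obtain ⟨c, d, hc, hd, hcd⟩ := exists_orthogonal_pair_ne_zero ζ hrank ![e, f, 0, 0] (by
      intro w
      refine ⟨![ζ w f / ζ e f, -ζ w e / ζ e f, 0, 0], ?_⟩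
      simp [Fin.forall_fin_succ, Fin.sum_univ_succ, hζalt, hfe]
      constructor <;> field_simp <;> ring)
    simp [Fin.forall_fin_succ] at hc hd
    obtain ⟨hce, hcf⟩ := hc
    obtain ⟨hde, hdf⟩ := hd
    have hec := hζs e c
    have hfc := hζs f c
    have hed := hζs e d
    have hfd := hζs f d
    have hdc := hζs d c
    rw [hce, neg_zero] at hec
    rw [hcf, neg_zero] at hfc
    rw [hde, neg_zero] at hed
    rw [hdf, neg_zero] at hfd
    obtain ⟨g, h, hg, hh, hgh⟩ := exists_orthogonal_pair_ne_zero ζ hrank ![e, f, c, d] (by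
      intro w
      refine ⟨![ζ w f / ζ e f, -ζ w e / ζ e f, ζ w d / ζ c d, -ζ w c / ζ c d], ?_⟩
      simp [Fin.forall_fin_succ, Fin.sum_univ_succ, hζalt, hfe, hce, hcf, hde, hdf, hec, hfc, hed,
        hfd, hdc]
      refine ⟨?_, ?_, ?_, ?_⟩ <;> field_simp <;> ring)
    simp [Fin.forall_fin_succ] at hg hh
    obtain ⟨hge, hgf, hgc, hgd⟩ := hg
    obtain ⟨hhe, hhf, hhc, hhd⟩ := hh
    have h1 := hW e f c d
    have h2 := hW g h e f
    have h3 := hW g h c d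
    simp only [hec, hed, hfc, hfd, hge, hgf, hhe, hhf, hgc, hgd, hhc, hhd] at h1 h2 h3
    have h4 : 2 * (ζ c d * ζ g h) * η e f = 0 := by
      linear_combination ζ g h * h1 + ζ c d * h2 - ζ e f * h3
    simpa [hcd, hgh] using h4
  have key' : ∀ x y, ζ x ≠ 0 → η x y = 0 := by
    intro x y hx
    by_cases hxy : ζ x y = 0
    · obtain ⟨z, hz⟩ := DFunLike.ne_iff.1 hx
      have h := key x (y + z) (by simpa [hxy] using hz)
      rwa [map_add, key x z hz, add_zero] at h
    · exact key x y hxy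
  obtain ⟨e, he⟩ := DFunLike.ne_iff.1 hζ
  ext x y
  by_cases hx : ζ x = 0
  · have h := key' (x + e) y (by simpa [hx] using he)
    simpa [key' e y he] using h
  · exact key' x y hx
end

section
/- Let V be a finite-dimensional real vector space and let ζ and η be 2-forms on V such that ζ ∧ η = 0 (as a 4-form) and ζ ≠ 0. If rank ζ = 4, then rank η ≤ 4 and ker ζ ⊆ ker η. -/
open Module

/-- The wedge product of two alternating forms, expanded as a sum over the `(2,2)`-shuffles. -/
theorem wedge22_eq {V : Type*} [AddCommGroup V] [Module ℝ V] (ζ η : V →ₗ[ℝ] V →ₗ[ℝ] ℝ)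
    (hζ : ζ.IsAlt) (hη : η.IsAlt) (a b c d : V) :
    wedge22 ζ η ![a, b, c, d] =
      4 * (ζ a b * η c d - ζ a c * η b d + ζ a d * η b c
        + ζ b c * η a d - ζ b d * η a c + ζ c d * η a b) := by
  have hz : ∀ x y, ζ x y = -ζ y x := fun x y => (hζ.neg y x).symm
  have he : ∀ x y, η x y = -η y x := fun x y => (hη.neg y x).symm
  have h1 : (1 : Fin 4) = Fin.succ 0 := rfl
  have h2 : (2 : Fin 4) = Fin.succ (Fin.succ 0) := rfl
  have h3 : (3 : Fin 4) = Fin.succ (Fin.succ (Fin.succ 0)) := rfl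
  simp only [wedge22, h1, h2, h3]
  simp only [Finset.univ_perm_fin_succ, Finset.sum_map, ← Finset.univ_product_univ,
    Finset.sum_product, Fin.sum_univ_succ, Finset.univ_unique, Finset.sum_singleton,
    Equiv.toEmbedding_apply, Equiv.Perm.decomposeFin.symm_sign,
    Equiv.Perm.decomposeFin_symm_apply_zero, Equiv.Perm.decomposeFin_symm_apply_succ,
    Equiv.swap_apply_def, Fin.succ_ne_zero, Fin.succ_inj, (Fin.succ_ne_zero _).symm]
  simp
  rw [hz b a, hz c a, hz d a, hz c b, hz d b, hz d c,
    he b a, he c a, he d a, he c b, he d b, he d c]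
  ring

/-- If `α ∧ ζ = 0` for a nonzero linear form `α`, then the alternating form `ζ` has rank
at most two. -/
theorem finrank_sub_finrank_ker_le_two {V : Type*} [AddCommGroup V] [Module ℝ V]
    [FiniteDimensional ℝ V] (ζ : V →ₗ[ℝ] V →ₗ[ℝ] ℝ) (α : V →ₗ[ℝ] ℝ) {w : V} (hw : α w ≠ 0)
    (h : ∀ x y z, α x * ζ y z - α y * ζ x z + α z * ζ x y = 0) :
    finrank ℝ V - finrank ℝ (LinearMap.ker ζ) ≤ 2 := by
  let f : V →ₗ[ℝ] ℝ × ℝ := α.prod (ζ w)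
  have hle : LinearMap.ker f ≤ LinearMap.ker ζ := by
    intro v hv
    obtain ⟨hα, hζ⟩ : α v = 0 ∧ ζ w v = 0 := by simpa [f] using hv
    ext u
    have := h w v u
    simpa [hα, hζ, hw] using this
  have h1 := Submodule.finrank_mono hle
  have h2 := f.finrank_range_add_finrank_ker
  have h3 : finrank ℝ (LinearMap.range f) ≤ 2 := by
    simpa using (LinearMap.range f).finrank_le
  omega

/-- If `ζ` and `η` are 2-forms on a finite-dimensional real vector space with
`ζ ∧ η = 0` and `ζ ≠ 0`, and `rank ζ = 4`, then `rank η ≤ 4` and `ker ζ ⊆ ker η`. -/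
theorem stmt1 {V : Type*} [AddCommGroup V] [Module ℝ V] [FiniteDimensional ℝ V]
    (ζ η : V →ₗ[ℝ] V →ₗ[ℝ] ℝ)
    (hζalt : ∀ v, ζ v v = 0) (hηalt : ∀ v, η v v = 0)
    (hwedge : ∀ v : Fin 4 → V, wedge22 ζ η v = 0)
    (hζ : ζ ≠ 0)
    (hrank : finrank ℝ V - finrank ℝ (LinearMap.ker ζ) = 4) :
    finrank ℝ V - finrank ℝ (LinearMap.ker η) ≤ 4 ∧
      LinearMap.ker ζ ≤ LinearMap.ker η := by
  have hker : LinearMap.ker ζ ≤ LinearMap.ker η := by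
    intro n hn
    have hn0 : ζ n = 0 := hn
    by_contra hne
    obtain ⟨w, hw⟩ : ∃ w, η n w ≠ 0 := by
      by_contra! h0
      exact hne (LinearMap.ext h0)
    have h := finrank_sub_finrank_ker_le_two ζ (η n) hw fun x y z => by
      have := hwedge ![n, x, y, z]
      rw [wedge22_eq ζ η hζalt hηalt] at this
      simp only [hn0, LinearMap.zero_apply] at this
      linarith
    omega
  have := Submodule.finrank_mono hker
  exact ⟨by omega, hker⟩
end

section
/- Let U be a finite-dimensional real vector space of dimension at least 4 and let ζ be a nondegenerate 2-form on U. If α is a linear functional (1-form) on U with ζ ∧ α = 0 (as a 3-form), then α = 0; i.e., wedging with ζ is injective from 1-forms to 3-forms. -/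
open Module

/-- The wedge product of a 2-form (alternating bilinear form) and a 1-form on a
real vector space `U`, evaluated on three vectors, given by the usual alternating
sum over all permutations (a positive multiple of the standard normalisation). -/
noncomputable def wedge21 {U : Type*} [AddCommGroup U] [Module ℝ U]
    (ζ : U →ₗ[ℝ] U →ₗ[ℝ] ℝ) (α : U →ₗ[ℝ] ℝ) : (Fin 3 → U) → ℝ :=
  fun v => ∑ σ : Equiv.Perm (Fin 3),
    ((Equiv.Perm.sign σ : ℤ) : ℝ) * (ζ (v (σ 0)) (v (σ 1)) * α (v (σ 2)))

/-- For an alternating form, `wedge21` is twice the cyclic sum. -/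
theorem wedge21_apply_of_alt {U : Type*} [AddCommGroup U] [Module ℝ U]
    (ζ : U →ₗ[ℝ] U →ₗ[ℝ] ℝ) (hζ : ∀ v, ζ v v = 0) (α : U →ₗ[ℝ] ℝ) (a b c : U) :
    wedge21 ζ α ![a, b, c] = 2 * (ζ a b * α c + ζ b c * α a + ζ c a * α b) := by
  have hskew (x y : U) : ζ y x = -ζ x y := (LinearMap.IsAlt.neg hζ x y).symm
  have huniv : (Finset.univ : Finset (Equiv.Perm (Fin 3))) =
      {1, Equiv.swap 0 1, Equiv.swap 0 2, Equiv.swap 1 2,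
        Equiv.swap 0 1 * Equiv.swap 1 2, Equiv.swap 1 2 * Equiv.swap 0 1} := by
    decide
  rw [wedge21, huniv]
  repeat rw [Finset.sum_insert (by decide)]
  rw [Finset.sum_singleton]
  simp [Equiv.swap_apply_def]
  rw [hskew a b, hskew b c, hskew c a]
  ring

/-- On a finite-dimensional real vector space of dimension at least 4 with a
nondegenerate 2-form `ζ`, wedging with `ζ` is injective on 1-forms: if
`ζ ∧ α = 0` then `α = 0`. -/
theorem stmt2 {U : Type*} [AddCommGroup U] [Module ℝ U] [FiniteDimensional ℝ U]
    (hdim : 4 ≤ finrank ℝ U)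
    (ζ : U →ₗ[ℝ] U →ₗ[ℝ] ℝ) (hζalt : ∀ v, ζ v v = 0)
    (hζnd : LinearMap.ker ζ = ⊥)
    (α : U →ₗ[ℝ] ℝ)
    (hwedge : ∀ v : Fin 3 → U, wedge21 ζ α v = 0) :
    α = 0 := by
  by_contra hα
  obtain ⟨u, hu⟩ : ∃ u, α u ≠ 0 := by
    by_contra! h
    exact hα (LinearMap.ext h)
  obtain ⟨k, hk, hk0⟩ : ∃ k ∈ LinearMap.ker (α.prod (ζ u)), k ≠ 0 :=
    Submodule.exists_mem_ne_zero_of_ne_bot <| LinearMap.ker_ne_bot_of_finrank_lt <| by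
      rw [finrank_prod, finrank_self]
      omega
  obtain ⟨hαk, hζk⟩ : α k = 0 ∧ ζ u k = 0 := by simpa using hk
  have hker : k ∈ LinearMap.ker ζ := by
    refine LinearMap.mem_ker.mpr (LinearMap.ext fun x => ?_)
    have h := hwedge ![k, x, u]
    rw [wedge21_apply_of_alt ζ hζalt, hαk, hζk] at h
    simpa [hu] using h
  rw [hζnd, Submodule.mem_bot] at hker
  exact hk0 hker
end

section
/- The map μ_ℍ is surjective onto the purely imaginary quaternions: for every purely imaginary quaternion p there exists a quaternion q with (1/2)·(star q * i * q) = p. -/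
open Quaternion

/-- The imaginary quaternion unit `i`. -/
def quatI : ℍ[ℝ] := ⟨0, 1, 0, 0⟩

/-- The hyperKähler moment map of the standard circle action on `ℍ`,
`μ_ℍ(q) = (1/2)·(q̄ i q)`. -/
noncomputable def muH (q : ℍ[ℝ]) : ℍ[ℝ] :=
  (1 / 2 : ℝ) • (star q * quatI * q)

theorem re_quatI : quatI.re = 0 := rfl

theorem imI_quatI : quatI.imI = 1 := rfl

theorem imJ_quatI : quatI.imJ = 0 := rfl

theorem imK_quatI : quatI.imK = 0 := rfl

theorem muH_eq_of_imI_eq_zero (q : ℍ[ℝ]) (hq : q.imI = 0) :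
    muH q =
      ⟨0, (q.re ^ 2 - q.imJ ^ 2 - q.imK ^ 2) / 2, -(q.re * q.imK), q.re * q.imJ⟩ := by
  ext <;>
    simp [muH, re_quatI, imI_quatI, imJ_quatI, imK_quatI, hq] <;>
    ring

theorem muH_mk (a c d : ℝ) :
    muH ⟨a, 0, c, d⟩ = ⟨0, (a ^ 2 - c ^ 2 - d ^ 2) / 2, -(a * d), a * c⟩ :=
  muH_eq_of_imI_eq_zero _ rfl

/-- `μ_ℍ` is surjective onto the purely imaginary quaternions. -/
theorem stmt5 (p : ℍ[ℝ]) (hp : p.re = 0) : ∃ q : ℍ[ℝ], muH q = p := by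
  obtain ⟨w, x, y, z⟩ := p
  obtain rfl : w = 0 := hp
  have hsq : 0 ≤ x ^ 2 + y ^ 2 + z ^ 2 := by positivity
  set n := √(x ^ 2 + y ^ 2 + z ^ 2) with hn
  have hn2 : n ^ 2 = x ^ 2 + y ^ 2 + z ^ 2 := Real.sq_sqrt hsq
  have hn0 : 0 ≤ n := Real.sqrt_nonneg _
  have hx : 0 ≤ n + x := by
    have : |x| ≤ n := Real.abs_le_sqrt (by nlinarith [sq_nonneg y, sq_nonneg z])
    linarith [neg_abs_le x]
  rcases hx.eq_or_lt with h | h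
  · have hnx : n = -x := by linarith
    have hyz : y ^ 2 + z ^ 2 = 0 := by rw [hnx] at hn2; linarith
    have hy : y = 0 := by nlinarith [sq_nonneg y, sq_nonneg z]
    have hz : z = 0 := by nlinarith [sq_nonneg y, sq_nonneg z]
    have hc : √(-2 * x) ^ 2 = -2 * x := Real.sq_sqrt (by linarith)
    refine ⟨⟨0, 0, √(-2 * x), 0⟩, ?_⟩
    rw [muH_mk, hc, hy, hz]
    ext <;> simp
  · have ha : √(n + x) ^ 2 = n + x := Real.sq_sqrt hx
    have ha0 : √(n + x) ≠ 0 := (Real.sqrt_pos.mpr h).ne'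
    refine ⟨⟨√(n + x), 0, z / √(n + x), -y / √(n + x)⟩, ?_⟩
    rw [muH_mk, div_pow, div_pow, ha]
    have hne : n + x ≠ 0 := h.ne'
    ext
    · rfl
    · change (n + x - z ^ 2 / (n + x) - (-y) ^ 2 / (n + x)) / 2 = x
      field_simp
      linarith
    · change -(√(n + x) * (-y / √(n + x))) = y
      field_simp
    · exact mul_div_cancel₀ z ha0
end

section
/- For every purely imaginary quaternion c there exists a quaternion q such that μ_ℍ(q) + c ≠ 0 and 2‖μ_ℍ(q) + c‖ ≤ ‖q‖². (This is the computational core of the fact that flat ℝ⁴ is not a hyperKähler modification: the inequality ‖X‖² < 2‖μ‖ fails at some point for every choice of constant c added to the moment map, where ‖X(q)‖² = ‖q‖² for the standard circle action.) -/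
open Quaternion

theorem star_mul_quatI_mul (q : ℍ[ℝ]) :
    star q * quatI * q =
      ⟨0, q.re ^ 2 + q.imI ^ 2 - q.imJ ^ 2 - q.imK ^ 2,
        2 * (q.imI * q.imJ - q.re * q.imK), 2 * (q.imI * q.imK + q.re * q.imJ)⟩ := by
  have hre : quatI.re = 0 := rfl
  have hI : quatI.imI = 1 := rfl
  have hJ : quatI.imJ = 0 := rfl
  have hK : quatI.imK = 0 := rfl
  apply Quaternion.ext <;>
    simp only [Quaternion.re_mul, Quaternion.imI_mul, Quaternion.imJ_mul, Quaternion.imK_mul,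
      Quaternion.re_star, Quaternion.imI_star, Quaternion.imJ_star, Quaternion.imK_star,
      hre, hI, hJ, hK] <;>
    ring

theorem exists_star_mul_quatI_mul_eq {c : ℍ[ℝ]} (hc : c.re = 0) :
    ∃ q : ℍ[ℝ], star q * quatI * q = c := by
  obtain ⟨n, hn0, hn⟩ : ∃ n : ℝ, 0 ≤ n ∧ n ^ 2 = c.imI ^ 2 + c.imJ ^ 2 + c.imK ^ 2 :=
    ⟨√(c.imI ^ 2 + c.imJ ^ 2 + c.imK ^ 2), Real.sqrt_nonneg _, Real.sq_sqrt (by positivity)⟩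
  have hle : -n ≤ c.imI := by
    apply neg_le_of_abs_le
    apply abs_le_of_sq_le_sq _ hn0
    nlinarith [sq_nonneg c.imJ, sq_nonneg c.imK]
  rcases hle.eq_or_lt with h | h
  · have hJ : c.imJ = 0 := by
      rw [← h] at hn
      nlinarith [sq_nonneg c.imJ, sq_nonneg c.imK]
    have hK : c.imK = 0 := by
      rw [← h] at hn
      nlinarith [sq_nonneg c.imJ, sq_nonneg c.imK]
    have hs := Real.sq_sqrt hn0
    refine ⟨⟨0, 0, √n, 0⟩, (star_mul_quatI_mul _).trans ?_⟩
    apply Quaternion.ext <;> simp [hc, hJ, hK, ← h, hs]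
  · obtain ⟨a, ha, ha2⟩ : ∃ a : ℝ, 0 < a ∧ a ^ 2 = (n + c.imI) / 2 :=
      ⟨√((n + c.imI) / 2), Real.sqrt_pos.2 (by linarith), Real.sq_sqrt (by linarith)⟩
    refine ⟨⟨a, 0, c.imK / (2 * a), -c.imJ / (2 * a)⟩, (star_mul_quatI_mul _).trans ?_⟩
    have hI : c.imI = 2 * a ^ 2 - n := by linarith
    rw [hI] at hn
    apply Quaternion.ext
    · exact hc.symm
    · rw [hI]
      field_simp
      linear_combination hn
    · field_simp
      ring
    · field_simp
      ring

theorem norm_star_mul_quatI_mul (q : ℍ[ℝ]) : ‖star q * quatI * q‖ = ‖q‖ ^ 2 := by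
  have hI : ‖quatI‖ = 1 := by
    have h : ‖quatI‖ * ‖quatI‖ = 1 := by
      rw [← Quaternion.normSq_eq_norm_mul_self, Quaternion.normSq_def']
      simp [quatI]
    nlinarith [norm_nonneg quatI]
  rw [norm_mul, norm_mul, norm_star, hI]
  ring

/-- For every purely imaginary quaternion `c` there is a point `q` at which the
shifted moment map `μ_ℍ + c` is nonzero and satisfies `2‖μ_ℍ(q) + c‖ ≤ ‖q‖²`:
the inequality `‖X‖² < 2‖μ‖` fails somewhere for every choice of constant `c`. -/
theorem stmt8 (c : ℍ[ℝ]) (hc : c.re = 0) :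
    ∃ q : ℍ[ℝ], muH q + c ≠ 0 ∧ 2 * ‖muH q + c‖ ≤ ‖q‖ ^ 2 := by
  by_cases h0 : c = 0
  · have h1 : ‖star (1 : ℍ[ℝ]) * quatI * 1‖ = 1 := by
      rw [norm_star_mul_quatI_mul, norm_one, one_pow]
    refine ⟨1, ?_, ?_⟩
    · rw [← norm_ne_zero_iff, h0, add_zero, muH, norm_smul, h1]
      norm_num
    · rw [h0, add_zero, muH, norm_smul, h1]
      norm_num
  · obtain ⟨q, hq⟩ := exists_star_mul_quatI_mul_eq (c := (-4 : ℝ) • c) (by simp [hc])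
    have hmu : muH q + c = -c := by
      rw [muH, hq]
      module
    have hnorm : ‖q‖ ^ 2 = 4 * ‖c‖ := by
      rw [← norm_star_mul_quatI_mul, hq, norm_smul]
      norm_num
    refine ⟨q, ?_, ?_⟩
    · rw [hmu]
      exact neg_ne_zero.2 h0
    · rw [hmu, norm_neg, hnorm]
      linarith [norm_nonneg c]
end

section
/- Let (pᵢ)_{i∈ℕ} be a sequence of pairwise distinct points of ℝ³ and suppose there exists q ∈ ℝ³ with q ≠ pᵢ for all i such that Σᵢ 1/‖q − pᵢ‖ converges. Then the series Σᵢ 1/‖p − pᵢ‖ converges uniformly in p on every compact subset of ℝ³ ∖ {pᵢ : i ∈ ℕ}. -/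
open Filter

/-- If `(pᵢ)` is a sequence of pairwise distinct points of `ℝ³` such that
`Σᵢ 1/‖q − pᵢ‖` converges for some `q` distinct from all the `pᵢ`, then the
series `Σᵢ 1/‖x − pᵢ‖` converges uniformly in `x` on every compact subset of
`ℝ³ ∖ {pᵢ : i ∈ ℕ}`: the net of partial sums over finite subsets of `ℕ`
tends uniformly on such compacta to the sum of the series. -/
theorem stmt10 (p : ℕ → EuclideanSpace ℝ (Fin 3)) (hp : Function.Injective p)
    (q : EuclideanSpace ℝ (Fin 3)) (hq : ∀ i, q ≠ p i)
    (hsum : Summable fun i => 1 / ‖q - p i‖) :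
    ∀ K : Set (EuclideanSpace ℝ (Fin 3)), IsCompact K → K ⊆ (Set.range p)ᶜ →
      TendstoUniformlyOn
        (fun (s : Finset ℕ) (x : EuclideanSpace ℝ (Fin 3)) => ∑ i ∈ s, 1 / ‖x - p i‖)
        (fun x => ∑' i, 1 / ‖x - p i‖) atTop K := by
  intro K hK _
  obtain ⟨R, hR, hKR⟩ := hK.isBounded.subset_ball_lt 0 q
  refine tendstoUniformlyOn_tsum_of_cofinite_eventually (hsum.mul_left 2) ?_
  have hfar : ∀ᶠ i in cofinite, 1 / ‖q - p i‖ < 1 / (2 * R) :=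
    hsum.tendsto_cofinite_zero.eventually_lt_const (by positivity)
  filter_upwards [hfar] with i hi x hx
  have hpos : 0 < ‖q - p i‖ := norm_pos_iff.mpr (sub_ne_zero.mpr (hq i))
  have hlt : 2 * R < ‖q - p i‖ := lt_of_one_div_lt_one_div hpos hi
  have hxq : ‖q - x‖ < R := mem_ball_iff_norm'.mp (hKR hx)
  have htri : ‖q - p i‖ ≤ ‖q - x‖ + ‖x - p i‖ := norm_sub_le_norm_sub_add_norm_sub q x (p i)
  have hhalf : ‖q - p i‖ / 2 ≤ ‖x - p i‖ := by linarith
  calc ‖1 / ‖x - p i‖‖ = 1 / ‖x - p i‖ := Real.norm_of_nonneg (by positivity)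
    _ ≤ 1 / (‖q - p i‖ / 2) := one_div_le_one_div_of_le (by positivity) hhalf
    _ = 2 * (1 / ‖q - p i‖) := by ring
end

section
/- Let (pᵢ)_{i∈ℕ} be a sequence of pairwise distinct points of ℝ³ and suppose there exists q ∈ ℝ³ with q ≠ pᵢ for all i such that Σᵢ 1/‖q − pᵢ‖ converges. Then the Anderson–Kronheimer–LeBrun potential W(p) = (1/2) Σᵢ 1/‖p − pᵢ‖ is a harmonic function on the open set ℝ³ ∖ {pᵢ : i ∈ ℕ}. -/
open Filter

/-- The Anderson–Kronheimer–LeBrun potential of the sequence of centres `p`: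
`W(x) = (1/2) Σᵢ 1/‖x − pᵢ‖`. -/
noncomputable def aklPotential (p : ℕ → EuclideanSpace ℝ (Fin 3)) :
    EuclideanSpace ℝ (Fin 3) → ℝ :=
  fun x => (1 / 2) * ∑' i, 1 / ‖x - p i‖

section NewtonKernel

set_option maxSynthPendingDepth 3

variable {E : Type*} [NormedAddCommGroup E] [InnerProductSpace ℝ E]

/-- The real inner product as a continuous bilinear map. -/
noncomputable def innerBilin (E : Type*) [NormedAddCommGroup E] [InnerProductSpace ℝ E] :
    E →L[ℝ] E →L[ℝ] ℝ :=
  innerSL ℝ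

lemma innerBilin_apply (x y : E) : innerBilin E x y = inner ℝ x y := rfl

lemma norm_innerBilin_apply (x : E) : ‖innerBilin E x‖ = ‖x‖ := innerSL_apply_norm ℝ x

lemma norm_innerBilin_le : ‖innerBilin E‖ ≤ 1 :=
  ContinuousLinearMap.opNorm_le_bound _ zero_le_one fun x => by
    rw [norm_innerBilin_apply, one_mul]

/-- The first derivative of `x ↦ ‖x‖⁻¹`. -/
noncomputable def newtonFDeriv (x : E) : E →L[ℝ] ℝ :=
  -(‖x‖⁻¹ ^ 3) • innerBilin E x

/-- The second derivative of `x ↦ ‖x‖⁻¹`. -/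
noncomputable def newtonFDeriv₂ (x : E) : E →L[ℝ] E →L[ℝ] ℝ :=
  (3 * ‖x‖⁻¹ ^ 5) • (innerBilin E x).smulRight (innerBilin E x) - ‖x‖⁻¹ ^ 3 • innerBilin E

lemma hasFDerivAt_norm_of_ne_zero {x : E} (hx : x ≠ 0) :
    HasFDerivAt (fun y : E => ‖y‖) (‖x‖⁻¹ • innerBilin E x) x := by
  have h := (hasStrictFDerivAt_norm_sq x).hasFDerivAt.sqrt (by simpa using hx)
  simp only [Real.sqrt_sq (norm_nonneg _)] at h
  convert! h using 1
  ext v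
  have : ‖x‖ ≠ 0 := norm_ne_zero_iff.2 hx
  simp only [_root_.smul_apply, innerBilin_apply, innerSL_apply_apply, smul_eq_mul,
    nsmul_eq_mul, Nat.cast_ofNat]
  field_simp

lemma hasFDerivAt_inv_norm {x : E} (hx : x ≠ 0) :
    HasFDerivAt (fun y : E => ‖y‖⁻¹) (newtonFDeriv x) x := by
  have hx' : ‖x‖ ≠ 0 := norm_ne_zero_iff.2 hx
  convert! (hasDerivAt_inv hx').comp_hasFDerivAt x (hasFDerivAt_norm_of_ne_zero hx) using 1
  rw [newtonFDeriv, smul_smul]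
  congr 1
  field_simp

lemma hasFDerivAt_newtonFDeriv {x : E} (hx : x ≠ 0) :
    HasFDerivAt (newtonFDeriv : E → E →L[ℝ] ℝ) (newtonFDeriv₂ x) x := by
  have h := ((hasFDerivAt_inv_norm hx).pow 3).fun_neg.fun_smul (innerBilin E).hasFDerivAt
  convert! h using 1
  ext v w
  simp only [newtonFDeriv₂, newtonFDeriv, _root_.sub_apply,
    _root_.add_apply, _root_.neg_apply, _root_.smul_apply,
    ContinuousLinearMap.smulRight_apply, smul_eq_mul, nsmul_eq_mul, innerBilin_apply]
  push_cast
  ring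

lemma norm_newtonFDeriv_le (x : E) : ‖newtonFDeriv x‖ ≤ ‖x‖⁻¹ ^ 2 := by
  rcases eq_or_ne x 0 with rfl | hx
  · simp [newtonFDeriv]
  have hx' : ‖x‖ ≠ 0 := norm_ne_zero_iff.2 hx
  rw [newtonFDeriv, norm_smul, norm_innerBilin_apply, norm_neg, norm_pow, norm_inv, norm_norm]
  apply le_of_eq
  field_simp

lemma norm_newtonFDeriv₂_le (x : E) : ‖newtonFDeriv₂ x‖ ≤ 4 * ‖x‖⁻¹ ^ 3 := by
  rcases eq_or_ne x 0 with rfl | hx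
  · simp [newtonFDeriv₂]
  have hx' : ‖x‖ ≠ 0 := norm_ne_zero_iff.2 hx
  have h₁ : ‖(3 * ‖x‖⁻¹ ^ 5) • (innerBilin E x).smulRight (innerBilin E x)‖
      = 3 * ‖x‖⁻¹ ^ 3 := by
    rw [norm_smul, ContinuousLinearMap.norm_smulRight_apply, norm_innerBilin_apply,
      Real.norm_of_nonneg (by positivity)]
    field_simp
  have h₂ : ‖‖x‖⁻¹ ^ 3 • innerBilin E‖ ≤ ‖x‖⁻¹ ^ 3 := by
    rw [norm_smul, Real.norm_of_nonneg (by positivity)]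
    exact mul_le_of_le_one_right (by positivity) norm_innerBilin_le
  calc ‖newtonFDeriv₂ x‖ ≤ _ := norm_sub_le _ _
    _ ≤ 4 * ‖x‖⁻¹ ^ 3 := by linarith

lemma continuousAt_newtonFDeriv₂ {x : E} (hx : x ≠ 0) :
    ContinuousAt (newtonFDeriv₂ : E → E →L[ℝ] E →L[ℝ] ℝ) x := by
  have hinv : ContinuousAt (fun y : E => ‖y‖⁻¹) x :=
    continuousAt_id.norm.inv₀ (norm_ne_zero_iff.2 hx)
  have hin : ContinuousAt (fun y : E => innerBilin E y) x := (innerBilin E).continuous.continuousAt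
  have hsr : ContinuousAt (fun y : E => (innerBilin E y).smulRight (innerBilin E y)) x :=
    ((ContinuousLinearMap.smulRightL ℝ E (E →L[ℝ] ℝ)).isBoundedBilinearMap.continuous.continuousAt
      (x := (innerBilin E x, innerBilin E x))).comp (f := fun y => (innerBilin E y, innerBilin E y))
      (hin.prodMk hin)
  exact ((continuousAt_const.mul (hinv.pow 5)).smul hsr).sub
    ((hinv.pow 3).smul continuousAt_const)

/-- In dimension three, `x ↦ ‖x‖⁻¹` has vanishing Laplacian. -/
lemma sum_newtonFDeriv₂_single (x : EuclideanSpace ℝ (Fin 3)) :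
    ∑ j : Fin 3, newtonFDeriv₂ x (EuclideanSpace.single j 1) (EuclideanSpace.single j 1) = 0 := by
  rcases eq_or_ne x 0 with rfl | hx
  · simp [newtonFDeriv₂]
  have hx' : ‖x‖ ≠ 0 := norm_ne_zero_iff.2 hx
  have hsq : ‖x‖ ^ 2 = x 0 ^ 2 + x 1 ^ 2 + x 2 ^ 2 := by
    simp [EuclideanSpace.norm_sq_eq, Fin.sum_univ_three]
  have hterm (j : Fin 3) :
      newtonFDeriv₂ x (EuclideanSpace.single j 1) (EuclideanSpace.single j 1)
        = 3 * ‖x‖⁻¹ ^ 5 * x j ^ 2 - ‖x‖⁻¹ ^ 3 := by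
    simp only [newtonFDeriv₂, _root_.sub_apply, _root_.smul_apply,
      ContinuousLinearMap.smulRight_apply, smul_eq_mul, innerBilin_apply]
    simp only [EuclideanSpace.inner_single_right, PiLp.single_apply, if_true, one_mul, conj_trivial]
    ring
  calc _ = 3 * ‖x‖⁻¹ ^ 5 * (x 0 ^ 2 + x 1 ^ 2 + x 2 ^ 2) - 3 * ‖x‖⁻¹ ^ 3 := by
        simp only [hterm, Fin.sum_univ_three]; ring
    _ = 0 := by rw [← hsq]; field_simp; ring

end NewtonKernel

section Distances

variable {E : Type*} [NormedAddCommGroup E] {p : ℕ → E} {q a : E}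

lemma tendsto_norm_sub_atTop (hq : ∀ i, q ≠ p i) (hsum : Summable fun i => 1 / ‖q - p i‖) :
    Tendsto (fun i => ‖q - p i‖) atTop atTop := by
  have h : Tendsto (fun i => (1 / ‖q - p i‖)) atTop (nhdsWithin 0 (Set.Ioi 0)) :=
    tendsto_nhdsWithin_iff.2 ⟨hsum.tendsto_atTop_zero, .of_forall fun i =>
      one_div_pos.2 (norm_pos_iff.2 (sub_ne_zero.2 (hq i)))⟩
  refine h.inv_tendsto_nhdsGT_zero.congr fun i => ?_
  simp

/-- Near a point off the centres, all the distances to the centres are bounded below by a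
positive constant. -/
lemma exists_ball_le_norm_sub (hlim : Tendsto (fun i => ‖q - p i‖) atTop atTop)
    (ha : a ∉ Set.range p) :
    ∃ δ > 0, ∀ i, ∀ x ∈ Metric.ball a δ, δ ≤ ‖x - p i‖ := by
  obtain ⟨N, hN⟩ := eventually_atTop.1 (hlim.eventually_ge_atTop (‖q - a‖ + 2))
  have hpos (i : ℕ) : 0 < ‖a - p i‖ :=
    norm_pos_iff.2 (sub_ne_zero.2 fun h => ha ⟨i, h.symm⟩)
  obtain ⟨r, hr, hrN⟩ : ∃ r > 0, ∀ i < N, r ≤ ‖a - p i‖ := by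
    have hfin : ∀ᶠ r in nhdsWithin (0 : ℝ) (Set.Ioi 0), ∀ i ∈ Set.Iio N, r ≤ ‖a - p i‖ :=
      (eventually_all_finite (Set.finite_Iio N)).2 fun i _ =>
        (eventually_le_nhds (hpos i)).filter_mono nhdsWithin_le_nhds
    obtain ⟨r, h, h0⟩ := (hfin.and self_mem_nhdsWithin).exists
    exact ⟨r, h0, h⟩
  refine ⟨min r 2 / 2, by positivity, fun i x hx => ?_⟩
  have hai : min r 2 ≤ ‖a - p i‖ := by
    rcases lt_or_ge i N with h | h
    · exact (min_le_left _ _).trans (hrN i h)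
    · have := norm_sub_le_norm_sub_add_norm_sub q a (p i)
      exact (min_le_right _ _).trans (by linarith [hN i h])
  have := norm_sub_le_norm_sub_add_norm_sub a x (p i)
  rw [Metric.mem_ball, dist_comm, dist_eq_norm] at hx
  linarith

/-- A series of inverse distances that converges at `q` is dominated, uniformly near any point off
the centres, by a multiple of the series at `q`. -/
lemma inv_norm_sub_le {δ : ℝ} (hδ : 0 < δ) (hq : ∀ i, q ≠ p i)
    (hball : ∀ i, ∀ x ∈ Metric.ball a δ, δ ≤ ‖x - p i‖) (i : ℕ) {x : E}
    (hx : x ∈ Metric.ball a δ) :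
    ‖x - p i‖⁻¹ ≤ ((‖q - a‖ + δ) / δ + 1) * (1 / ‖q - p i‖) := by
  have hd := hball i x hx
  have hqi : 0 < ‖q - p i‖ := norm_pos_iff.2 (sub_ne_zero.2 (hq i))
  have h₁ := norm_sub_le_norm_sub_add_norm_sub q x (p i)
  have h₂ := norm_sub_le_norm_sub_add_norm_sub q a x
  rw [Metric.mem_ball, dist_comm, dist_eq_norm] at hx
  have h₃ : ‖q - a‖ + δ ≤ (‖q - a‖ + δ) / δ * ‖x - p i‖ := by
    rw [div_mul_eq_mul_div, le_div_iff₀ hδ]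
    gcongr
  rw [mul_one_div, le_div_iff₀ hqi, inv_mul_le_iff₀ (hδ.trans_le hd)]
  linarith

end Distances

section Series

set_option maxSynthPendingDepth 3

variable {E : Type*} [NormedAddCommGroup E] [InnerProductSpace ℝ E] {p : ℕ → E} {q a : E}

/-- Around each point off the centres, the series of inverse distances can be differentiated twice
termwise, with continuous second derivative. -/
lemma exists_ball_hasFDerivAt_tsum_inv_norm_sub (hq : ∀ i, q ≠ p i)
    (hsum : Summable fun i => 1 / ‖q - p i‖) (ha : a ∉ Set.range p) :
    ∃ δ > 0,
      (∀ x ∈ Metric.ball a δ, HasFDerivAt (fun y => ∑' i, 1 / ‖y - p i‖)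
        (∑' i, newtonFDeriv (x - p i)) x) ∧
      (∀ x ∈ Metric.ball a δ, HasFDerivAt (fun y => ∑' i, newtonFDeriv (y - p i))
        (∑' i, newtonFDeriv₂ (x - p i)) x) ∧
      (∀ x ∈ Metric.ball a δ, Summable fun i => newtonFDeriv₂ (x - p i)) ∧
      ContinuousOn (fun x => ∑' i, newtonFDeriv₂ (x - p i)) (Metric.ball a δ) := by
  obtain ⟨δ, hδ, hball⟩ := exists_ball_le_norm_sub (tendsto_norm_sub_atTop hq hsum) ha
  set u : ℕ → ℝ := fun i => ((‖q - a‖ + δ) / δ + 1) * (1 / ‖q - p i‖)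
  have hu : Summable u := hsum.mul_left _
  have hle (i : ℕ) (x : E) (hx : x ∈ Metric.ball a δ) : ‖x - p i‖⁻¹ ≤ u i :=
    inv_norm_sub_le hδ hq hball i hx
  have hinv (i : ℕ) (x : E) (hx : x ∈ Metric.ball a δ) : ‖x - p i‖⁻¹ ≤ δ⁻¹ :=
    inv_anti₀ hδ (hball i x hx)
  have hne (i : ℕ) (x : E) (hx : x ∈ Metric.ball a δ) : x - p i ≠ 0 :=
    norm_pos_iff.1 (hδ.trans_le (hball i x hx))
  have hb₁ (i : ℕ) (x : E) (hx : x ∈ Metric.ball a δ) :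
      ‖newtonFDeriv (x - p i)‖ ≤ δ⁻¹ * u i := by
    refine (norm_newtonFDeriv_le _).trans ?_
    rw [pow_two]
    exact mul_le_mul (hinv i x hx) (hle i x hx) (by positivity) (by positivity)
  have hb₂ (i : ℕ) (x : E) (hx : x ∈ Metric.ball a δ) :
      ‖newtonFDeriv₂ (x - p i)‖ ≤ 4 * δ⁻¹ ^ 2 * u i := by
    refine (norm_newtonFDeriv₂_le _).trans ?_
    rw [pow_succ, ← mul_assoc]
    exact mul_le_mul
      (mul_le_mul_of_nonneg_left (pow_le_pow_left₀ (by positivity) (hinv i x hx) 2) (by norm_num))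
      (hle i x hx) (by positivity) (by positivity)
  have haδ : a ∈ Metric.ball a δ := Metric.mem_ball_self hδ
  have hconn : IsPreconnected (Metric.ball a δ) := (convex_ball a δ).isPreconnected
  refine ⟨δ, hδ, fun x hx => ?_, fun x hx => ?_, fun x hx => ?_, ?_⟩
  · simp only [one_div]
    refine hasFDerivAt_tsum_of_isPreconnected (hu.mul_left δ⁻¹) Metric.isOpen_ball hconn
      (fun i y hy => ?_) hb₁ haδ ?_ hx
    · exact (hasFDerivAt_comp_sub (p i)).2 (hasFDerivAt_inv_norm (hne i y hy))
    · exact hu.of_nonneg_of_le (fun i => by positivity) fun i => hle i a haδ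
  · refine hasFDerivAt_tsum_of_isPreconnected (hu.mul_left (4 * δ⁻¹ ^ 2)) Metric.isOpen_ball hconn
      (fun i y hy => ?_) hb₂ haδ ?_ hx
    · exact (hasFDerivAt_comp_sub (p i)).2 (hasFDerivAt_newtonFDeriv (hne i y hy))
    · exact .of_norm_bounded (hu.mul_left δ⁻¹) fun i => hb₁ i a haδ
  · exact .of_norm_bounded (hu.mul_left (4 * δ⁻¹ ^ 2)) fun i => hb₂ i x hx
  · refine continuousOn_tsum (fun i x hx => ?_) (hu.mul_left (4 * δ⁻¹ ^ 2)) hb₂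
    exact ((continuousAt_newtonFDeriv₂ (hne i x hx)).comp (f := fun y => y - p i)
      (by fun_prop)).continuousWithinAt

end Series

/-- If `(pᵢ)` is a sequence of pairwise distinct points of `ℝ³` such that
`Σᵢ 1/‖q − pᵢ‖` converges for some `q` distinct from all the `pᵢ`, then the
Anderson–Kronheimer–LeBrun potential `W(x) = (1/2) Σᵢ 1/‖x − pᵢ‖` is harmonic
on the open set `ℝ³ ∖ {pᵢ : i ∈ ℕ}`: it is twice continuously differentiable
there and its Laplacian vanishes. -/
theorem stmt11 (p : ℕ → EuclideanSpace ℝ (Fin 3)) (hp : Function.Injective p)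
    (q : EuclideanSpace ℝ (Fin 3)) (hq : ∀ i, q ≠ p i)
    (hsum : Summable fun i => 1 / ‖q - p i‖) :
    ContDiffOn ℝ 2 (aklPotential p) (Set.range p)ᶜ ∧
      ∀ x ∈ (Set.range p)ᶜ,
        ∑ j : Fin 3,
          fderiv ℝ (fderiv ℝ (aklPotential p)) x (EuclideanSpace.single j 1)
            (EuclideanSpace.single j 1) = 0 := by
  refine ⟨fun a ha => ContDiffAt.contDiffWithinAt ?_, fun a ha => ?_⟩
  · obtain ⟨δ, hδ, h₁, h₂, -, hc⟩ := exists_ball_hasFDerivAt_tsum_inv_norm_sub hq hsum ha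
    have hmem : Metric.ball a δ ∈ nhds a := Metric.ball_mem_nhds a hδ
    have hf₁ : ContDiffAt ℝ ((0 : ℕ) + 1) (fun y => ∑' i, newtonFDeriv (y - p i)) a :=
      contDiffAt_succ_iff_hasFDerivAt.2 ⟨_, ⟨_, hmem, h₂⟩,
        contDiffAt_zero.2 ⟨_, hmem, hc⟩⟩
    have hf : ContDiffAt ℝ ((1 : ℕ) + 1) (fun y => ∑' i, 1 / ‖y - p i‖) a :=
      contDiffAt_succ_iff_hasFDerivAt.2 ⟨_, ⟨_, hmem, h₁⟩, by simpa using hf₁⟩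
    have hf' : ContDiffAt ℝ 2 (fun y => ∑' i, 1 / ‖y - p i‖) a := by
      convert! hf using 1
    exact contDiffAt_const.mul hf'
  · obtain ⟨δ, hδ, h₁, h₂, hs, -⟩ := exists_ball_hasFDerivAt_tsum_inv_norm_sub hq hsum ha
    have haδ : a ∈ Metric.ball a δ := Metric.mem_ball_self hδ
    have hfd : fderiv ℝ (aklPotential p) =ᶠ[nhds a]
        fun y => (1 / 2 : ℝ) • ∑' i, newtonFDeriv (y - p i) := by
      filter_upwards [Metric.ball_mem_nhds a hδ] with x hx
      exact ((h₁ x hx).const_mul (1 / 2)).fderiv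
    have happly (v : EuclideanSpace ℝ (Fin 3)) :
        HasSum (fun i => newtonFDeriv₂ (a - p i) v v) ((∑' i, newtonFDeriv₂ (a - p i)) v v) :=
      ((hs a haδ).hasSum.mapL (ContinuousLinearMap.apply ℝ _ v)).mapL
        (ContinuousLinearMap.apply ℝ ℝ v)
    have hzero := hasSum_sum fun j (_ : j ∈ (Finset.univ : Finset (Fin 3))) =>
      happly (EuclideanSpace.single j 1)
    simp only [sum_newtonFDeriv₂_single] at hzero
    rw [hfd.fderiv_eq, ((h₂ a haδ).fun_const_smul (1 / 2 : ℝ)).fderiv]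
    simp only [_root_.smul_apply, ← Finset.smul_sum, hzero.unique hasSum_zero,
      smul_zero]
end

section
/- Let V be a finite-dimensional left module over the quaternions ℍ and let ζ be an alternating ℝ-bilinear form on V (viewing V as a real vector space) that is invariant under the imaginary quaternion units: ζ(a•v, a•w) = ζ(v, w) for all v, w ∈ V and a ∈ {i, j, k}. Then ker ζ = {v ∈ V : ζ(v, w) = 0 for all w ∈ V} is an ℍ-submodule of V, and the rank of ζ, namely dim_ℝ V − dim_ℝ ker ζ, is divisible by 4. -/
open Quaternion Module

/-- A bilinear form invariant under a scalar `a` with right inverse `b` has kernel stable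
under `a`. -/
lemma smul_mem_ker_of_invariant {R A V : Type*} [CommRing R] [Ring A] [AddCommGroup V]
    [Module R V] [Module A V] (ζ : V →ₗ[R] V →ₗ[R] R) {a b : A} (hab : a * b = 1)
    (ha : ∀ v w : V, ζ (a • v) (a • w) = ζ v w) {v : V} (hv : v ∈ LinearMap.ker ζ) :
    a • v ∈ LinearMap.ker ζ := by
  rw [LinearMap.mem_ker] at hv ⊢
  ext w
  have h := ha v (b • w)
  rw [smul_smul, hab, one_smul] at h
  simp [h, hv]

/-- A real subspace of a quaternionic module stable under the quaternions has real dimension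
divisible by 4. -/
lemma four_dvd_finrank_of_smul_mem {V : Type*} [AddCommGroup V] [Module ℍ[ℝ] V] [Module ℝ V]
    [IsScalarTower ℝ ℍ[ℝ] V] (K : Submodule ℝ V)
    (hK : ∀ (a : ℍ[ℝ]) (v : V), v ∈ K → a • v ∈ K) : 4 ∣ finrank ℝ K := by
  let U : Submodule ℍ[ℝ] V := { K with smul_mem' := fun a v hv => hK a v hv }
  have hU : 4 ∣ finrank ℝ U :=
    Quaternion.finrank_eq_four (R := ℝ) ▸ Dvd.intro _ (finrank_mul_finrank ℝ ℍ[ℝ] U)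
  exact hU

/-- Let `V` be a finite-dimensional left `ℍ`-module and `ζ` an alternating real
bilinear form on `V` invariant under the imaginary quaternion units `i`, `j`, `k`.
Then `ker ζ` is an `ℍ`-submodule of `V` and the rank of `ζ` is divisible by 4. -/
theorem stmt14 (V : Type*) [AddCommGroup V] [Module ℍ[ℝ] V]
    [Module ℝ V] [IsScalarTower ℝ ℍ[ℝ] V] [FiniteDimensional ℝ V]
    (ζ : V →ₗ[ℝ] V →ₗ[ℝ] ℝ) (hζalt : ∀ v, ζ v v = 0)
    (hinv : ∀ a : ℍ[ℝ],
      (a = (⟨0, 1, 0, 0⟩ : ℍ[ℝ]) ∨ a = (⟨0, 0, 1, 0⟩ : ℍ[ℝ]) ∨ a = (⟨0, 0, 0, 1⟩ : ℍ[ℝ])) →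
      ∀ v w : V, ζ (a • v) (a • w) = ζ v w) :
    (∀ (a : ℍ[ℝ]) (v : V), v ∈ LinearMap.ker ζ → a • v ∈ LinearMap.ker ζ) ∧
      4 ∣ (finrank ℝ V - finrank ℝ (LinearMap.ker ζ)) := by
  have hker : ∀ (a : ℍ[ℝ]) (v : V), v ∈ LinearMap.ker ζ → a • v ∈ LinearMap.ker ζ := by
    intro a v hv
    have hunit : ∀ u : ℍ[ℝ], (u = (⟨0, 1, 0, 0⟩ : ℍ[ℝ]) ∨ u = (⟨0, 0, 1, 0⟩ : ℍ[ℝ]) ∨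
        u = (⟨0, 0, 0, 1⟩ : ℍ[ℝ])) → u • v ∈ LinearMap.ker ζ := by
      intro u hu
      refine smul_mem_ker_of_invariant ζ (b := -u) ?_ (hinv u hu) hv
      rcases hu with h | h | h <;> ext <;> simp <;> simp [h]
    obtain ⟨i, hi⟩ : ∃ i : ℍ[ℝ], i = ⟨0, 1, 0, 0⟩ := ⟨_, rfl⟩
    obtain ⟨j, hj⟩ : ∃ j : ℍ[ℝ], j = ⟨0, 0, 1, 0⟩ := ⟨_, rfl⟩
    obtain ⟨k, hk⟩ : ∃ k : ℍ[ℝ], k = ⟨0, 0, 0, 1⟩ := ⟨_, rfl⟩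
    have hdecomp : a = a.re • (1 : ℍ[ℝ]) + a.imI • i + a.imJ • j + a.imK • k := by
      ext <;> simp <;> simp [hi, hj, hk]
    rw [hdecomp]
    simp only [add_smul, smul_assoc, one_smul]
    exact add_mem (add_mem (add_mem (Submodule.smul_mem _ _ hv)
      (Submodule.smul_mem _ _ (hunit _ (.inl hi))))
      (Submodule.smul_mem _ _ (hunit _ (.inr (.inl hj)))))
      (Submodule.smul_mem _ _ (hunit _ (.inr (.inr hk))))
  refine ⟨hker, Nat.dvd_sub ?_ (four_dvd_finrank_of_smul_mem _ hker)⟩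
  rw [← finrank_top ℝ V]
  exact four_dvd_finrank_of_smul_mem ⊤ fun _ _ _ => Submodule.mem_top
end
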